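/- arXiv:2002.12175 — 2 statements merged into one kernel-verified Lean document; each statement's English description precedes it below -/
import Mathlib

section
/- For every natural number k ≥ 6, the system S₁ = 0, S₂ = 0, S₃ = 0 has at least four pairwise distinct solutions (z₁, z₂, z₃) ∈ ℝ³ with z₁ > 0, z₂ > 0 and z₃ > 0. (These are singularities at infinity of the normalized Ricci flow on the Stiefel manifold SO(1+2k)/SO(k), giving at least four invariant Einstein metrics.) -/
/-- First polynomial of the compactified normalized Ricci flow at infinity for the
Stiefel manifold SO(1+2k)/SO(k). -/
noncomputable def S₁ (k z₁ z₂ z₃ : ℝ) : ℝ :=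
  z₁ * (k * z₁ * (-z₁ ^ 2 * z₂ + z₁ * z₃ + z₂ * (z₂ - z₃) ^ 2)
    + (z₁ - 1) * z₂ ^ 2 * z₃ * (k * (z₁ - 1) - 2 * z₁))

/-- Second polynomial of the compactified normalized Ricci flow at infinity for the
Stiefel manifold SO(1+2k)/SO(k). -/
noncomputable def S₂ (k z₁ z₂ z₃ : ℝ) : ℝ :=
  z₂ * (z₁ ^ 2 * z₃ * ((k - 2) * z₂ ^ 2 + (2 - 4 * k) * z₂ + 2 * k - 1)
    + z₁ ^ 3 * z₂ + z₁ * z₂ * (z₃ ^ 2 - z₂ ^ 2) + z₂ ^ 2 * z₃)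

/-- Third polynomial of the compactified normalized Ricci flow at infinity for the
Stiefel manifold SO(1+2k)/SO(k). -/
noncomputable def S₃ (k z₁ z₂ z₃ : ℝ) : ℝ :=
  z₃ * (k * z₁ * (z₁ ^ 2 * z₂ + z₁ * (z₂ ^ 2 * (z₃ - 4) + z₃) + z₂ ^ 3 - z₂ * z₃ ^ 2)
    + z₂ ^ 2 * (z₃ - 2 * z₁ ^ 2 * (z₃ - 1)))

/-- A positive solution of the system S₁ = S₂ = S₃ = 0. -/
def IsPosSol (k : ℝ) (p : ℝ × ℝ × ℝ) : Prop :=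
  0 < p.1 ∧ 0 < p.2.1 ∧ 0 < p.2.2 ∧
    S₁ k p.1 p.2.1 p.2.2 = 0 ∧ S₂ k p.1 p.2.1 p.2.2 = 0 ∧ S₃ k p.1 p.2.1 p.2.2 = 0

/-- leading coefficient (in `s`) of the eliminant -/
noncomputable def qa (k t : ℝ) : ℝ := 2 * k * t ^ 2 - (k + 1)
/-- linear coefficient of the eliminant -/
noncomputable def qb (k t : ℝ) : ℝ := -(4 * k - 2) * (t ^ 2 - t)
/-- constant coefficient of the eliminant -/
noncomputable def qc (k t : ℝ) : ℝ :=
  -2 * k * t ^ 4 + (4 * k - 2) * t ^ 3 + (k + 1) + (k - 1) * t ^ 2 - (4 * k - 2) * t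

/-- denominator of `z₁` -/
noncomputable def Df (k t s : ℝ) : ℝ := 2 * (s - t) * (k * (s + t) - (2 * k - 1))

/-- second eliminant -/
noncomputable def Ff (k t s : ℝ) : ℝ :=
  (k - 2) * (k - 1) ^ 2 * s ^ 2
    - (k - 1) * (k * (1 + t ^ 2 - s ^ 2) - (4 * k - 2) * t) * Df k t s
    + (1 + k * t ^ 2) * Df k t s ^ 2

/-- upper root of a quadratic -/
noncomputable def qroot (a b c : ℝ) : ℝ := (-b + √(b ^ 2 - 4 * a * c)) / (2 * a)

lemma core (k t s : ℝ) (hk : 6 ≤ k) (ht : 0 < t) (hs : 0 < s) (hD : Df k t s < 0)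
    (hE : qa k t * s ^ 2 + qb k t * s + qc k t = 0) (hF : Ff k t s = 0) :
    ∃ p : ℝ × ℝ × ℝ, IsPosSol k p ∧ p.2.2 = s * p.2.1 := by
  obtain ⟨a, ha⟩ : ∃ a, a = -(k - 1) * s / Df k t s := ⟨_, rfl⟩
  have hD0 : Df k t s ≠ 0 := hD.ne
  have haD : a * Df k t s = -(k - 1) * s := by rw [ha]; field_simp
  have hapos : 0 < a := by
    rw [ha]; apply div_pos_of_neg_of_neg _ hD
    nlinarith
  obtain ⟨b, hb⟩ : ∃ b, b = a / t := ⟨_, rfl⟩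
  have hab : a = t * b := by rw [hb]; field_simp
  have hbpos : 0 < b := by rw [hb]; positivity
  -- third reduced equation
  have hC : (k - 2) * s * a ^ 2 + a * (k * (1 + t ^ 2 - s ^ 2) - (4 * k - 2) * t)
      + s * (1 + k * t ^ 2) = 0 := by
    have h1 : Df k t s ^ 2 * ((k - 2) * s * a ^ 2
        + a * (k * (1 + t ^ 2 - s ^ 2) - (4 * k - 2) * t) + s * (1 + k * t ^ 2)) = 0 := by
      unfold Ff at hF
      linear_combination s * hF + ((k - 2) * s * (a * Df k t s - (k - 1) * s)
        + Df k t s * (k * (1 + t ^ 2 - s ^ 2) - (4 * k - 2) * t)) * haD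
    rcases mul_eq_zero.mp h1 with h | h
    · exact absurd h (pow_ne_zero 2 hD0)
    · exact h
  have hA : (k - 2) * s * a ^ 2 + a * (k * (1 + s ^ 2 - t ^ 2) - (4 * k - 2) * s)
      + s * (k * (1 + t ^ 2)) = 0 := by
    unfold Df at haD
    linear_combination hC + haD
  have hB : (k - 2) * s * a ^ 2 + a * (t ^ 2 + s ^ 2 - 1 - (4 * k - 2) * t * s)
      + s * (1 + (2 * k - 1) * t ^ 2) = 0 := by
    unfold Df at haD
    unfold qa qb qc at hE
    linear_combination hC + t ^ 2 * haD - a * hE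
  refine ⟨(a, b, s * b), ⟨hapos, hbpos, mul_pos hs hbpos, ?_, ?_, ?_⟩, rfl⟩
  · simp only [S₁]
    rw [hab] at hA ⊢
    linear_combination (t * b) * b ^ 3 * hA
  · simp only [S₂]
    rw [hab] at hB ⊢
    linear_combination b * b ^ 3 * hB
  · simp only [S₃]
    rw [hab] at hC ⊢
    linear_combination (s * b) * b ^ 3 * hC

lemma qroot_eq (a b c : ℝ) (ha : 0 < a) (hd : 0 ≤ b ^ 2 - 4 * a * c) :
    a * qroot a b c ^ 2 + b * qroot a b c + c = 0 := by
  have h := Real.sq_sqrt hd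
  unfold qroot
  generalize √(b ^ 2 - 4 * a * c) = r at *
  field_simp
  linear_combination h

lemma disc_pos (a b c x : ℝ) (ha : 0 < a) (hx : a * x ^ 2 + b * x + c < 0) :
    0 < b ^ 2 - 4 * a * c := by
  nlinarith [sq_nonneg (2 * a * x + b)]

lemma lt_qroot (a b c x : ℝ) (ha : 0 < a) (hx : a * x ^ 2 + b * x + c < 0) :
    x < qroot a b c := by
  unfold qroot
  rw [lt_div_iff₀ (by positivity)]
  have : 2 * a * x + b < √(b ^ 2 - 4 * a * c) := by
    apply Real.lt_sqrt_of_sq_lt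
    nlinarith
  linarith

lemma qroot_lt (a b c x y : ℝ) (ha : 0 < a) (hx : a * x ^ 2 + b * x + c < 0)
    (hxy : x < y) (hy : 0 < a * y ^ 2 + b * y + c) : qroot a b c < y := by
  have h0 := qroot_eq a b c ha (disc_pos a b c x ha hx).le
  have h1 := lt_qroot a b c x ha hx
  by_contra! h
  generalize qroot a b c = s at *
  -- y lies in (x, s], convexity
  have : (s - x) * (a * y ^ 2 + b * y + c) ≤ 0 := by
    have e : (s - x) * (a * y ^ 2 + b * y + c)
        = (s - y) * (a * x ^ 2 + b * x + c) + (y - x) * (a * s ^ 2 + b * s + c)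
          - a * (s - x) * (s - y) * (y - x) := by ring
    rw [e, h0]
    have p1 : 0 ≤ s - y := by linarith
    have p2 : 0 < y - x := by linarith
    have p3 : 0 < s - x := by linarith
    have : 0 ≤ a * (s - x) * (s - y) * (y - x) := by positivity
    nlinarith
  nlinarith [mul_pos (sub_pos.mpr h1) hy]

lemma qroot_of_eq (a b c x : ℝ) (ha : 0 < a) (hx : a * x ^ 2 + b * x + c = 0)
    (h : 0 ≤ 2 * a * x + b) : qroot a b c = x := by
  unfold qroot
  have e : b ^ 2 - 4 * a * c = (2 * a * x + b) ^ 2 := by linear_combination -4 * a * hx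
  rw [e, Real.sqrt_sq h]
  field_simp
  ring

/-- linear coefficient of the remainder -/
noncomputable def r1 (a b c f1 f2 f3 f4 : ℝ) : ℝ :=
  a ^ 3 * f1 - a ^ 2 * b * f2 + a * (b ^ 2 - a * c) * f3 + (2 * a * b * c - b ^ 3) * f4
/-- constant coefficient of the remainder -/
noncomputable def r0 (a b c f0 f2 f3 f4 : ℝ) : ℝ :=
  a ^ 3 * f0 - a ^ 2 * c * f2 + a * b * c * f3 + (a * c ^ 2 - b ^ 2 * c) * f4

lemma remainder (a b c s f0 f1 f2 f3 f4 : ℝ) (h : a * s ^ 2 + b * s + c = 0) :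
    a ^ 3 * (f4 * s ^ 4 + f3 * s ^ 3 + f2 * s ^ 2 + f1 * s + f0)
      = r1 a b c f1 f2 f3 f4 * s + r0 a b c f0 f2 f3 f4 := by
  unfold r1 r0
  linear_combination (a ^ 2 * f2 + a * (a * s - b) * f3
    + (a ^ 2 * s ^ 2 - a * b * s + (b ^ 2 - a * c)) * f4) * h

lemma scaled (a b c p q : ℝ) (hp : p ≠ 0) :
    a * (-q / p) ^ 2 + b * (-q / p) + c = (a * q ^ 2 - b * q * p + c * p ^ 2) / p ^ 2 := by
  field_simp
  ring

lemma neg_of_res (a b c p q : ℝ) (ha : 0 < a) (hp : p < 0)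
    (hR : a * q ^ 2 - b * q * p + c * p ^ 2 < 0) : p * qroot a b c + q < 0 := by
  have h := lt_qroot a b c (-q / p) ha (by
    rw [scaled _ _ _ _ _ hp.ne]; exact div_neg_of_neg_of_pos hR (sq_pos_of_neg hp))
  rw [div_lt_iff_of_neg hp] at h
  linarith

lemma pos_of_res (a b c p q : ℝ) (ha : 0 < a) (hp : p < 0) (h1 : a + b + c < 0)
    (hpq : 0 < p + q)
    (hR : 0 < a * q ^ 2 - b * q * p + c * p ^ 2) : 0 < p * qroot a b c + q := by
  have h := qroot_lt a b c 1 (-q / p) ha (by linarith)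
    (by rw [lt_div_iff_of_neg hp]; linarith)
    (by rw [scaled _ _ _ _ _ hp.ne]; exact div_pos hR (sq_pos_of_neg hp))
  rw [lt_div_iff_of_neg hp] at h
  linarith

lemma F_expand (k t s : ℝ) :
    Ff k t s = ((k - 1) * k * (2 * k) + (1 + k * t ^ 2) * (2 * k) ^ 2) * s ^ 4
      + ((k - 1) * k * (2 - 4 * k) + 2 * (1 + k * t ^ 2) * (2 * k) * (2 - 4 * k)) * s ^ 3
      + ((k - 2) * (k - 1) ^ 2 - (k - 1) * (k * (1 + t ^ 2) - (4 * k - 2) * t) * (2 * k)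
        + (k - 1) * k * (-2 * t * (k * t - 2 * k + 1))
        + (1 + k * t ^ 2) * ((2 - 4 * k) ^ 2
          + 2 * (2 * k) * (-2 * t * (k * t - 2 * k + 1)))) * s ^ 2
      + (-(k - 1) * (k * (1 + t ^ 2) - (4 * k - 2) * t) * (2 - 4 * k)
        + 2 * (1 + k * t ^ 2) * (2 - 4 * k) * (-2 * t * (k * t - 2 * k + 1))) * s
      + (-(k - 1) * (k * (1 + t ^ 2) - (4 * k - 2) * t) * (-2 * t * (k * t - 2 * k + 1))
        + (1 + k * t ^ 2) * (-2 * t * (k * t - 2 * k + 1)) ^ 2) := by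
  unfold Ff Df; ring

lemma F_lo (k : ℝ) (hk : 6 ≤ k) :
    Ff k (3/10) (qroot (-qa k (3/10)) (-qb k (3/10)) (-qc k (3/10))) < 0 := by
  obtain ⟨x, hx, rfl⟩ : ∃ x : ℝ, 0 ≤ x ∧ k = x + 6 := ⟨k - 6, by linarith, by ring⟩
  have ha : 0 < -qa (x + 6) (3/10) := by unfold qa; ring_nf; positivity
  have h1 : -qa (x + 6) (3/10) * 1 ^ 2 + -qb (x + 6) (3/10) * 1 + -qc (x + 6) (3/10) < 0 := by
    unfold qa qb qc; ring_nf; linarith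
  have hE := qroot_eq _ _ _ ha (disc_pos _ _ _ _ ha h1).le
  rw [F_expand]
  refine neg_of_mul_neg_right ?_ (pow_pos ha 3).le
  rw [remainder _ _ _ _ _ _ _ _ _ hE]
  apply neg_of_res _ _ _ _ _ ha
  · rw [← neg_pos]; unfold r1 qa qb qc; ring_nf; positivity
  · rw [← neg_pos]; unfold r1 r0 qa qb qc; ring_nf; positivity

lemma F_mid (k : ℝ) (hk : 6 ≤ k) :
    0 < Ff k (2/5) (qroot (-qa k (2/5)) (-qb k (2/5)) (-qc k (2/5))) := by
  obtain ⟨x, hx, rfl⟩ : ∃ x : ℝ, 0 ≤ x ∧ k = x + 6 := ⟨k - 6, by linarith, by ring⟩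
  have ha : 0 < -qa (x + 6) (2/5) := by unfold qa; ring_nf; positivity
  have h1 : -qa (x + 6) (2/5) * 1 ^ 2 + -qb (x + 6) (2/5) * 1 + -qc (x + 6) (2/5) < 0 := by
    unfold qa qb qc; ring_nf; linarith
  have hE := qroot_eq _ _ _ ha (disc_pos _ _ _ _ ha h1).le
  rw [F_expand]
  refine pos_of_mul_pos_right ?_ (pow_pos ha 3).le
  rw [remainder _ _ _ _ _ _ _ _ _ hE]
  apply pos_of_res _ _ _ _ _ ha
  · rw [← neg_pos]; unfold r1 qa qb qc; ring_nf; positivity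
  · linarith
  · unfold r1 r0 qa qb qc; ring_nf; positivity
  · unfold r1 r0 qa qb qc; ring_nf; positivity

lemma F_hi (k : ℝ) (hk : 6 ≤ k) :
    Ff k (31/20) (qroot (qa k (31/20)) (qb k (31/20)) (qc k (31/20))) < 0 := by
  obtain ⟨x, hx, rfl⟩ : ∃ x : ℝ, 0 ≤ x ∧ k = x + 6 := ⟨k - 6, by linarith, by ring⟩
  have ha : 0 < qa (x + 6) (31/20) := by unfold qa; ring_nf; positivity
  have h1 : qa (x + 6) (31/20) * (1/2) ^ 2 + qb (x + 6) (31/20) * (1/2) + qc (x + 6) (31/20) < 0 := by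
    unfold qa qb qc; ring_nf; linarith
  have hE := qroot_eq _ _ _ ha (disc_pos _ _ _ _ ha h1).le
  rw [F_expand]
  refine neg_of_mul_neg_right ?_ (pow_pos ha 3).le
  rw [remainder _ _ _ _ _ _ _ _ _ hE]
  apply neg_of_res _ _ _ _ _ ha
  · rw [← neg_pos]; unfold r1 qa qb qc; ring_nf; positivity
  · rw [← neg_pos]; unfold r1 r0 qa qb qc; ring_nf; positivity

/-- the value of the first eliminant on the line `s + t = 2 - 1/k` -/
lemma E_line (k t m : ℝ) (hm : k * m = 2 * k - 1) :
    qa k t * (m - t) ^ 2 + qb k t * (m - t) + qc k t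
      = -(4 * k * t ^ 2 - 4 * k * m * t + (k + 1) * (m ^ 2 - 1)) := by
  unfold qa qb qc
  linear_combination (2 * t ^ 2 * (m - 2 * t) - 2 * t * (m - t - 1) - 2 * t ^ 2 + 2 * m * t) * hm

lemma E_one (k t : ℝ) :
    qa k t + qb k t + qc k t = t ^ 2 * (-2 * k * t ^ 2 + (4 * k - 2) * t - (k - 1)) := by
  unfold qa qb qc; ring

lemma Ff_cont (k : ℝ) (g : ℝ → ℝ) (S : Set ℝ) (hg : ContinuousOn g S) :
    ContinuousOn (fun t => Ff k t (g t)) S := by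
  unfold Ff Df; fun_prop

lemma curve_cont (k u v : ℝ) (e : ℝ) (h : ∀ t ∈ Set.Icc u v, e * qa k t ≠ 0) :
    ContinuousOn (fun t => Ff k t (qroot (e * qa k t) (e * qb k t) (e * qc k t)))
      (Set.Icc u v) := by
  have h1 : ContinuousOn (fun t => qroot (e * qa k t) (e * qb k t) (e * qc k t))
      (Set.Icc u v) := by
    unfold qroot
    apply ContinuousOn.div
    · unfold qa qb qc; fun_prop
    · unfold qa; fun_prop
    · intro t ht
      exact mul_ne_zero two_ne_zero (h t ht)
  exact Ff_cont k (fun t => qroot (e * qa k t) (e * qb k t) (e * qc k t)) _ h1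

lemma sol3 (k : ℝ) (hk : 6 ≤ k) :
    ∃ p : ℝ × ℝ × ℝ, IsPosSol k p ∧ p.2.1 < p.2.2 := by
  have hqa : ∀ t ∈ Set.Icc (3/10 : ℝ) (2/5), 0 < -1 * qa k t := by
    rintro t ⟨h1, h2⟩
    unfold qa
    nlinarith [mul_nonneg (sub_nonneg.mpr h1) (sub_nonneg.mpr h2)]
  have hc := curve_cont k (3/10) (2/5) (-1) (fun t ht => (hqa t ht).ne')
  have hlo := F_lo k hk
  have hmid := F_mid k hk
  simp only [← neg_one_mul (qa _ _), ← neg_one_mul (qb _ _), ← neg_one_mul (qc _ _)] at hlo hmid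
  obtain ⟨t, ht, hF⟩ := intermediate_value_Icc (by norm_num) hc ⟨hlo.le, hmid.le⟩
  have ha := hqa t ht
  obtain ⟨h1, h2⟩ := ht
  simp only at hF
  have hp := mul_nonneg (sub_nonneg.mpr h1) (sub_nonneg.mpr h2)
  have hone : -1 * qa k t * 1 ^ 2 + -1 * qb k t * 1 + -1 * qc k t < 0 := by
    have e := E_one k t
    have : 0 < -2 * k * t ^ 2 + (4 * k - 2) * t - (k - 1) := by nlinarith
    have : 0 < t ^ 2 * (-2 * k * t ^ 2 + (4 * k - 2) * t - (k - 1)) := by positivity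
    linarith
  have hE := qroot_eq _ _ _ ha (disc_pos _ _ _ _ ha hone).le
  have hs1 := lt_qroot _ _ _ _ ha hone
  obtain ⟨m, hm⟩ : ∃ m : ℝ, k * m = 2 * k - 1 := ⟨(2 * k - 1) / k, by field_simp⟩
  have hm1 : 3/2 < m := by nlinarith
  have hline : 0 < -1 * qa k t * (m - t) ^ 2 + -1 * qb k t * (m - t) + -1 * qc k t := by
    have e := E_line k t m hm
    have : 0 < 4 * k * t ^ 2 - 4 * k * m * t + (k + 1) * (m ^ 2 - 1) := by
      have e2 : 4 * k * t ^ 2 - 4 * k * m * t + (k + 1) * (m ^ 2 - 1)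
          = k * (4 * t ^ 2 - 8 * t + 3) + 4 * t - 3 + (m ^ 2 - m) := by
        linear_combination (-4 * t + m + 2) * hm
      have h3 : 0.44 ≤ 4 * t ^ 2 - 8 * t + 3 := by nlinarith
      have h4 : 0.44 * 6 ≤ k * (4 * t ^ 2 - 8 * t + 3) := by nlinarith
      have h5 : 0 < m ^ 2 - m := by nlinarith
      rw [e2]; linarith
    linarith
  have hs2 := qroot_lt _ _ _ _ _ ha hone (by linarith) hline
  generalize qroot (-1 * qa k t) (-1 * qb k t) (-1 * qc k t) = s at *
  have hD : Df k t s < 0 := by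
    unfold Df
    rw [← hm]
    have : 0 < k * (m - (s + t)) := mul_pos (by linarith) (by linarith)
    have : 0 < s - t := by linarith
    nlinarith
  obtain ⟨p, hp, hps⟩ := core k t s hk (by linarith) (by linarith) hD (by linarith) hF
  refine ⟨p, hp, ?_⟩
  have := hp.2.1
  rw [hps]; nlinarith

lemma sol4 (k : ℝ) (hk : 6 ≤ k) :
    ∃ p : ℝ × ℝ × ℝ, IsPosSol k p ∧ p.2.2 < p.2.1 := by
  obtain ⟨h, hh⟩ : ∃ h : ℝ, h = 1 / k := ⟨_, rfl⟩
  have hkh : k * h = 1 := by rw [hh]; field_simp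
  have hpos : 0 < h := by rw [hh]; positivity
  have hle : h ≤ 1/6 := by nlinarith
  obtain ⟨m, hmh⟩ : ∃ m : ℝ, m = 2 - h := ⟨_, rfl⟩
  have hm : k * m = 2 * k - 1 := by rw [hmh]; linear_combination -hkh
  -- left endpoint
  have hr0 : h ^ 2 < 1 - h * (m ^ 2 - 1) := by rw [hmh]; nlinarith
  have hr2 := Real.sq_sqrt ((sq_nonneg h).trans hr0.le)
  have hrh : h < √(1 - h * (m ^ 2 - 1)) := Real.lt_sqrt_of_sq_lt hr0
  have hrl : √(1 - h * (m ^ 2 - 1)) ≤ 1 := by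
    rw [Real.sqrt_le_one]
    rw [hmh]; nlinarith
  generalize √(1 - h * (m ^ 2 - 1)) = r at *
  obtain ⟨t0, ht0⟩ : ∃ t0 : ℝ, t0 = (m + r) / 2 := ⟨_, rfl⟩
  have h01 : 1 < t0 := by rw [ht0]; linarith
  have h02 : t0 < 31/20 := by rw [ht0]; linarith
  have hfac : ∀ t, 4 * k * t ^ 2 - 4 * k * m * t + (k + 1) * (m ^ 2 - 1)
      = 4 * k * ((t - t0) * (t - (m - r) / 2)) := by
    intro t
    rw [ht0]
    linear_combination k * hr2 - (m ^ 2 - 1) * hkh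
  have hqa : ∀ t ∈ Set.Icc t0 (31/20 : ℝ), 0 < 1 * qa k t := by
    rintro t ⟨h1, h2⟩
    unfold qa
    have : 1 < t ^ 2 := by nlinarith
    nlinarith
  have hc := curve_cont k t0 (31/20) 1 (fun t ht => (hqa t ht).ne')
  have hhi : Ff k (31/20) (qroot (1 * qa k (31/20)) (1 * qb k (31/20)) (1 * qc k (31/20))) < 0 := by
    simpa only [one_mul] using F_hi k hk
  have hlo : 0 < Ff k t0 (qroot (1 * qa k t0) (1 * qb k t0) (1 * qc k t0)) := by
    have hs : qroot (1 * qa k t0) (1 * qb k t0) (1 * qc k t0) = m - t0 := by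
      apply qroot_of_eq _ _ _ _ (hqa t0 ⟨le_rfl, h02.le⟩)
      · have e1 := E_line k t0 m hm
        have e2 := hfac t0
        rw [sub_self, zero_mul, mul_zero] at e2
        linarith
      · have hq : t0 * (m - t0) = (1 + h) * (m ^ 2 - 1) / 4 := by
          rw [ht0]; linear_combination -hr2 / 4
        have e : 2 * (1 * qa k t0) * (m - t0) + 1 * qb k t0
            = 2 * k * (t0 * (1/2 + 7/2 * h - 5/2 * h ^ 2 + 1/2 * h ^ 3)
              + m * ((1 + h) * (m ^ 2 - 1) / 4) - (1 + h) * m) := by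
          have e1 : 2 * (1 * qa k t0) * (m - t0) + 1 * qb k t0
            = 2 * k * (t0 * (2 * (t0 * (m - t0)) - m ^ 2 + m + 1 + h)
              + m * (t0 * (m - t0)) - (1 + h) * m) := by
            unfold qa qb
            linear_combination 2 * (m - t0) * hkh + 2 * (t0 ^ 2 - t0) * hm
          rw [e1, hq, hmh]
          ring
        rw [e]
        have c1 : 0 < 1/2 + 7/2 * h - 5/2 * h ^ 2 + 1/2 * h ^ 3 := by
          have : 0 < h ^ 3 := by positivity
          nlinarith
        have c2 : 0 ≤ (1/2 + 7/2 * h - 5/2 * h ^ 2 + 1/2 * h ^ 3)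
              + m * ((1 + h) * (m ^ 2 - 1) / 4) - (1 + h) * m := by
          have e3 : (1/2 + 7/2 * h - 5/2 * h ^ 2 + 1/2 * h ^ 3)
              + m * ((1 + h) * (m ^ 2 - 1) / 4) - (1 + h) * m
              = h * ((5/4 - 11/4 * h) + h ^ 2 * (7/4 - h / 4)) := by rw [hmh]; ring
          rw [e3]
          have : 0 ≤ 5/4 - 11/4 * h := by linarith
          have : 0 ≤ 7/4 - h / 4 := by linarith
          positivity
        have c3 := mul_pos (sub_pos.mpr h01) c1
        apply mul_nonneg (by linarith)
        linarith
    have hD : Df k t0 (m - t0) = 0 := by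
      unfold Df; linear_combination 2 * (m - t0 - t0) * hm
    rw [hs]
    unfold Ff
    rw [hD]
    have : 0 < m - t0 := by linarith
    have : 0 < k - 2 := by linarith
    have : 0 < k - 1 := by linarith
    have : 0 < (k - 2) * (k - 1) ^ 2 * (m - t0) ^ 2 := by positivity
    linarith
  obtain ⟨t, ht, hF⟩ := intermediate_value_Icc' h02.le hc ⟨hhi.le, hlo.le⟩
  have ha := hqa t ht
  obtain ⟨h1, h2⟩ := ht
  simp only at hF
  have h1 : t0 < t := by
    rcases h1.lt_or_eq with h | h
    · exact h
    · subst h; linarith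
  have hline : 1 * qa k t * (m - t) ^ 2 + 1 * qb k t * (m - t) + 1 * qc k t < 0 := by
    have e := E_line k t m hm
    have e2 := hfac t
    have : 0 < 4 * k * ((t - t0) * (t - (m - r) / 2)) :=
      mul_pos (by linarith) (mul_pos (by linarith) (by linarith))
    linarith
  have hone : 0 < 1 * qa k t * 1 ^ 2 + 1 * qb k t * 1 + 1 * qc k t := by
    have e := E_one k t
    have hp : 0 ≤ (t - 1) * (31/20 - t) := mul_nonneg (by linarith) (by linarith)
    have : 0 < -2 * k * t ^ 2 + (4 * k - 2) * t - (k - 1) := by nlinarith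
    have : 0 < t ^ 2 * (-2 * k * t ^ 2 + (4 * k - 2) * t - (k - 1)) := by
      have : 0 < t := by linarith
      positivity
    linarith
  have hE := qroot_eq _ _ _ ha (disc_pos _ _ _ _ ha hline).le
  have hs1 := lt_qroot _ _ _ _ ha hline
  have hs2 := qroot_lt _ _ _ _ _ ha hline (by linarith) hone
  generalize qroot (1 * qa k t) (1 * qb k t) (1 * qc k t) = s at *
  have hD : Df k t s < 0 := by
    unfold Df
    rw [← hm]
    have : 0 < k * (s + t - m) := mul_pos (by linarith) (by linarith)
    have : 0 < t - s := by linarith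
    nlinarith
  obtain ⟨p, hp, hps⟩ := core k t s hk (by linarith) (by linarith) hD (by linarith) hF
  refine ⟨p, hp, ?_⟩
  have := hp.2.1
  rw [hps]; nlinarith

lemma jensen (k b : ℝ) (hb : 0 < b) (h : (k - 1) * b ^ 2 + (2 - 4 * k) * b + 2 * k = 0) :
    IsPosSol k (1, b, b) := by
  refine ⟨one_pos, hb, hb, ?_, ?_, ?_⟩
  · simp only [S₁]; ring
  · simp only [S₂]; linear_combination b ^ 2 * h
  · simp only [S₃]; linear_combination b ^ 2 * h

lemma jensen_two (k : ℝ) (hk : 6 ≤ k) : ∃ b c : ℝ, 0 < b ∧ b < c ∧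
    (k - 1) * b ^ 2 + (2 - 4 * k) * b + 2 * k = 0 ∧
    (k - 1) * c ^ 2 + (2 - 4 * k) * c + 2 * k = 0 := by
  have hd : 0 < 2 * k ^ 2 - 2 * k + 1 := by nlinarith
  have h2 := Real.sq_sqrt hd.le
  have h1 := Real.sqrt_pos.mpr hd
  set r := √(2 * k ^ 2 - 2 * k + 1)
  have hk1 : 0 < k - 1 := by linarith
  have hr : r < 2 * k - 1 := by nlinarith
  refine ⟨(2 * k - 1 - r) / (k - 1), (2 * k - 1 + r) / (k - 1), ?_, ?_, ?_, ?_⟩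
  · apply div_pos <;> linarith
  · gcongr; linarith
  · field_simp; linear_combination h2
  · field_simp; linear_combination h2

theorem stiefel_at_least_four_singularities (k : ℕ) (hk : 6 ≤ k) :
    ∃ p₁ p₂ p₃ p₄ : ℝ × ℝ × ℝ,
      p₁ ≠ p₂ ∧ p₁ ≠ p₃ ∧ p₁ ≠ p₄ ∧ p₂ ≠ p₃ ∧ p₂ ≠ p₄ ∧ p₃ ≠ p₄ ∧
      IsPosSol (k : ℝ) p₁ ∧ IsPosSol (k : ℝ) p₂ ∧
      IsPosSol (k : ℝ) p₃ ∧ IsPosSol (k : ℝ) p₄ := by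
  have hk' : (6 : ℝ) ≤ k := by exact_mod_cast hk
  obtain ⟨b, c, hb, hbc, h1, h2⟩ := jensen_two k hk'
  obtain ⟨p, hp, hp'⟩ := sol3 k hk'
  obtain ⟨q, hq, hq'⟩ := sol4 k hk'
  refine ⟨(1, b, b), (1, c, c), p, q, ?_, ?_, ?_, ?_, ?_, ?_, jensen k b hb h1,
    jensen k c (hb.trans hbc) h2, hp, hq⟩
  · intro h
    simp only [Prod.mk.injEq] at h
    exact hbc.ne h.2.1
  · rintro rfl; exact lt_irrefl _ hp'
  · rintro rfl; exact lt_irrefl _ hq'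
  · rintro rfl; exact lt_irrefl _ hp'
  · rintro rfl; exact lt_irrefl _ hq'
  · rintro rfl; exact lt_asymm hp' hq'
end

section
/- The system T₁ = 0, T₂ = 0, T₃ = 0 (the case k₂ = 4, k₃ = 2) has exactly four solutions (z₁, z₂, z₃) ∈ ℝ³ with z₁ > 0, z₂ > 0 and z₃ > 0. (These are the singularities at infinity of the normalized Ricci flow on the Stiefel manifold V₅ℝ⁷ = SO(7)/SO(2), corresponding to its four invariant Einstein metrics.) -/
/-- First polynomial of the compactified normalized Ricci flow at infinity for the
Stiefel manifold V_{1+k₂}ℝⁿ = SO(n)/SO(k₃), n = 1+k₂+k₃. -/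
noncomputable def T₁ (k₂ k₃ z₁ z₂ z₃ : ℝ) : ℝ :=
  z₁ * ((z₁ - 1) * z₂ ^ 2 * z₃ * (2 * z₁ - k₂ * (z₁ - 1))
    + k₃ * z₁ * (z₁ ^ 2 * z₂ - z₁ * z₃ - z₂ * (z₂ - z₃) ^ 2))

/-- Second polynomial of the compactified normalized Ricci flow at infinity for the
Stiefel manifold V_{1+k₂}ℝⁿ = SO(n)/SO(k₃), n = 1+k₂+k₃. -/
noncomputable def T₂ (k₂ k₃ z₁ z₂ z₃ : ℝ) : ℝ :=
  z₂ * (-z₃ * (z₁ ^ 2 * (-2 * z₂ * (k₂ + k₃ - 1) + (k₂ - 2) * z₂ ^ 2 + k₂ + k₃ - 1)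
      + z₂ ^ 2)
    - z₁ * z₂ * z₃ ^ 2 + z₁ * z₂ * (z₂ - z₁) * (z₁ + z₂))

/-- Third polynomial of the compactified normalized Ricci flow at infinity for the
Stiefel manifold V_{1+k₂}ℝⁿ = SO(n)/SO(k₃), n = 1+k₂+k₃. -/
noncomputable def T₃ (k₂ k₃ z₁ z₂ z₃ : ℝ) : ℝ :=
  -z₃ * (k₂ * z₁ * z₂ * (z₁ * z₂ * z₃ + (z₁ - z₂) ^ 2 - z₃ ^ 2)
    + z₁ ^ 2 * (k₃ * z₃ - 2 * z₂ ^ 2 * (k₃ + z₃ - 1)) + z₂ ^ 2 * z₃)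

noncomputable def aa (x u : ℝ) : ℝ := -3 - 6 * u^2 + 5 * x + 10 * x * u
       - 3 * x^2

noncomputable def PP (x u : ℝ) : ℝ :=
  aa x u * (-2 * x^2 - 2 * u^2 + 10 * x - 4 - aa x u) + 4 * x^2 * (u^2 - 1)

noncomputable def QQ (x u : ℝ) : ℝ :=
  aa x u * (x^2 + u^2 + 1/2 - aa x u) + x^2 * (4 * u^2 - 10 * u + 4)

noncomputable def hh (u : ℝ) : ℝ :=
    601875 - 4926250 * u + 20567500 * u^2 - 55868000 * u^3
       + 105439675 * u^4 - 141888350 * u^5 + 137946250 * u^6 - 97049440 * u^7 + 48245892 * u^8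
       - 15481800 * u^9 + 2412504 * u^10

noncomputable def hd (u : ℝ) : ℝ :=
    -4926250 + 41135000 * u - 167604000 * u^2 + 421758700 * u^3
       - 709441750 * u^4 + 827677500 * u^5 - 679346080 * u^6 + 385967136 * u^7 - 139336200 * u^8
       + 24125040 * u^9

noncomputable def NN (u : ℝ) : ℝ :=
    51050 + 19200 * u + 749750 * u^2 - 1975980 * u^3
       + 1771544 * u^4 - 595800 * u^5

noncomputable def DD (u : ℝ) : ℝ :=
    -739925 + 3592500 * u - 6382525 * u^2 + 5250960 * u^3
       - 1712754 * u^4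

noncomputable def s1 (u : ℝ) : ℝ :=
    -526500 + 1046400 * u + 6370300 * u^2 - 27700560 * u^3
       + 37769800 * u^4 + 1042128 * u^5 - 66700400 * u^6 + 88560192 * u^7 - 52639200 * u^8
       + 12768192 * u^9

noncomputable def s0 (u : ℝ) : ℝ :=
    504900 - 2428200 * u + 3985500 * u^2 + 1687080 * u^3
       - 22660368 * u^4 + 59893968 * u^5 - 99616704 * u^6 + 114953952 * u^7 - 89521920 * u^8
       + 42679872 * u^9 - 9471168 * u^10

set_option maxHeartbeats 4000000 in
lemma elim_R (x u : ℝ) (hP : PP x u = 0) (hQ : QQ x u = 0) :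
    (6 * u^2 - 10 * u + 3) * hh u = 0 := by
  have key : -36 * (2 * u^2 + 1)^2 * ((6 * u^2 - 10 * u + 3) * hh u) =
    (-6324750 + 40906500 * u - 153168200 * u^2 + 610900700 * u^3
       - 1955208630 * u^4 + 3779506620 * u^5 - 4054739196 * u^6 + 2261724000 * u^7 - 1314149416 * u^8
       + 2706222160 * u^9 - 3621165072 * u^10 + 2270998080 * u^11 - 565066368 * u^12 + 5788125 * x
       + 39766500 * x * u - 457060125 * x * u^2 + 1170211500 * x * u^3 + 46783500 * x * u^4 - 5468758020 * x * u^5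
       + 10863097440 * x * u^6 - 8054250840 * x * u^7 - 1707258240 * x * u^8 + 7556248080 * x * u^9 - 5365848240 * x * u^10
       + 1370403360 * x * u^11 - 8474625 * x^2 + 48510750 * x^2 * u + 12363125 * x^2 * u^2 - 671098550 * x^2 * u^3
       + 1942126880 * x^2 * u^4 - 2100065780 * x^2 * u^5 - 512298760 * x^2 * u^6 + 4010945080 * x^2 * u^7 - 4750292400 * x^2 * u^8
       + 2631512880 * x^2 * u^9 - 602892720 * x^2 * u^10 - 1974375 * x^3 + 3924000 * x^3 * u + 23888625 * x^3 * u^2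
       - 103877100 * x^3 * u^3 + 141636750 * x^3 * u^4 + 3907980 * x^3 * u^5 - 250126500 * x^3 * u^6 + 332100720 * x^3 * u^7
       - 197397000 * x^3 * u^8 + 47880720 * x^3 * u^9) * (2 * (4 * PP x u - QQ x u)) +
    (73203750 - 364027500 * u + 1058242500 * u^2 - 4550125500 * u^3
       + 16073393550 * u^4 - 32445575100 * u^5 + 36374886600 * u^6 - 21847275000 * u^7 + 9742920000 * u^8
       - 13410406800 * u^9 + 17586266400 * u^10 - 10921586400 * u^11 + 2629648800 * u^12 - 73153125 * x
       - 380137500 * x * u + 4026538125 * x * u^2 - 8482171000 * x * u^3 - 5223553500 * x * u^4 + 48861766100 * x * u^5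
       - 82872159600 * x * u^6 + 53032899800 * x * u^7 + 17451873600 * x * u^8 - 52002162000 * x * u^9 + 33585807600 * x * u^10
       - 7923938400 * x * u^11 + 98718750 * x^2 - 314662500 * x^2 * u - 958991250 * x^2 * u^2 + 6627172500 * x^2 * u^3
       - 13314463500 * x^2 * u^4 + 8302806000 * x^2 * u^5 + 12740803800 * x^2 * u^6 - 31612626000 * x^2 * u^7 + 29795893200 * x^2 * u^8
       - 14237856000 * x^2 * u^9 + 2872843200 * x^2 * u^10) * PP x u := by
    unfold PP QQ aa hh
    ring
  rw [hP, hQ] at key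
  have h2 : (2 * u^2 + 1 : ℝ) ^ 2 ≠ 0 := by positivity
  have h3 : (-36 * (2 * u^2 + 1)^2 : ℝ) ≠ 0 := mul_ne_zero (by norm_num) h2
  apply (mul_eq_zero.mp (key.trans (by ring))).resolve_left h3

set_option maxHeartbeats 4000000 in
lemma elim_L (x u : ℝ) (hP : PP x u = 0) (hQ : QQ x u = 0) :
    s1 u * x + s0 u = 0 := by
  have key : s1 u * x + s0 u =
    (33135 - 108780 * u - 26688 * u^2 + 559728 * u^3
       - 987948 * u^4 + 754416 * u^5 - 221184 * u^6 + 10425 * x - 69830 * x * u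
       + 212280 * x * u^2 - 320872 * x * u^3 + 252060 * x * u^4 - 88344 * x * u^5 + 765 * x^2
       - 10680 * x^2 * u + 26040 * x^2 * u^2 - 26640 * x^2 * u^3 + 11340 * x^2 * u^4) * (2 * (4 * PP x u - QQ x u)) +
    (-328725 + 822300 * u + 673750 * u^2 - 4883600 * u^3
       + 7496580 * u^4 - 5173200 * u^5 + 1389960 * u^6 - 38250 * x + 579900 * x * u
       - 1942800 * x * u^2 + 2894400 * x * u^3 - 2165400 * x * u^4 + 680400 * x * u^5) * PP x u := by
    unfold PP QQ aa s1 s0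
    ring
  rw [key, hP, hQ]
  ring

lemma rel_ND (u : ℝ) (hu : hh u = 0) : s1 u * NN u + s0 u * DD u = 0 := by
  have key : s1 u * NN u + s0 u * DD u = (-665364 + 624880 * u + 3022096 * u^2 - 5624480 * u^3
       + 3570768 * u^4) * hh u := by
    unfold s1 s0 NN DD hh
    ring
  rw [key, hu, mul_zero]

set_option maxHeartbeats 4000000 in
lemma van_PP (u : ℝ) (hu : hh u = 0) (hD : DD u ≠ 0) : PP (NN u / DD u) u = 0 := by
  have e : ∀ x d : ℝ, d ≠ 0 → d^4 * PP (x / d) u =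
    3 * d^4 - 6 * d^4 * u^2 - 24 * d^4 * u^4 - 20 * x * d^3
       + 20 * x * d^3 * u - 10 * x * d^3 * u^2 + 100 * x * d^3 * u^3 + 21 * x^2 * d^2 - 114 * x^2 * d^2 * u^2
       - 10 * x^3 * d + 40 * x^3 * d * u - 3 * x^4 := by
    intro x d hd
    unfold PP aa
    field_simp
    ring
  have key : DD u ^ 4 * PP (NN u / DD u) u = (2232635758623523125 - 21638963007015301250 * u + 92245878606682743750 * u^2 - 232440384715170411500 * u^3
       + 383327133553107281825 * u^4 - 422054598446993061350 * u^5 + 295428560286513555200 * u^6 - 106747767491934207420 * u^7 - 4083483879122809132 * u^8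
       + 18615025858283007360 * u^9 - 4883021232869695536 * u^10) * hh u := by
    rw [e _ _ hD]
    unfold NN DD hh
    ring
  rw [hu, mul_zero] at key
  exact (mul_eq_zero.mp key).resolve_left (pow_ne_zero 4 hD)

set_option maxHeartbeats 4000000 in
lemma van_QQ (u : ℝ) (hu : hh u = 0) (hD : DD u ≠ 0) : QQ (NN u / DD u) u = 0 := by
  have e : ∀ x d : ℝ, d ≠ 0 → d^4 * QQ (x / d) u =
    -(21/2) * d^4 - 42 * d^4 * u^2 - 42 * d^4 * u^4 + (65/2) * x * d^3
       + 65 * x * d^3 * u + 65 * x * d^3 * u^2 + 130 * x * d^3 * u^3 - (87/2) * x^2 * d^2 - 110 * x^2 * d^2 * u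
       - 141 * x^2 * d^2 * u^2 + 35 * x^3 * d + 70 * x^3 * d * u - 12 * x^4 := by
    intro x d hd
    unfold QQ aa
    field_simp
    ring
  have key : DD u ^ 4 * QQ (NN u / DD u) u = (-(12909724967330830625/2) + 63008122924578654375 * u - 298096014857978510000 * u^2 + 880197646873169135250 * u^3
       - (3534250199619672881025/2) * u^4 + 2505443695171277795475 * u^5 - 2542726319575928092925 * u^6 + 1832538396497754604320 * u^7 - 902893518926013257878 * u^8
       + 275593952520834089460 * u^9 - 39484849384293058188 * u^10) * hh u := by
    rw [e _ _ hD]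
    unfold NN DD hh
    ring
  rw [hu, mul_zero] at key
  exact (mul_eq_zero.mp key).resolve_left (pow_ne_zero 4 hD)

lemma hh_pos0 (u : ℝ) (h1 : 0 ≤ u) (h2 : u ≤ (33/50)) : 0 < hh u := by
  have key : ∀ p q : ℝ, 0 ≤ p → 0 ≤ q → 0 < p + q →
      0 < 2449035644531250000000 * q^10 + 11260681152343750000000 * p * q^9 + 27594616699218750000000 * p^2 * q^8 + 43900950000000000000000 * p^3 * q^7
       + 47665398252392578125000 * p^4 * q^6 + 35379314978267578125000 * p^5 * q^5 + 17768074951456054687500 * p^6 * q^4 + 5797293979386547500000 * p^7 * q^3 + 1112274618504644163750 * p^8 * q^2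
       + 98346980630701128750 * p^9 * q + 1142775703067455429 * p^10 := by
    intro p q hp hq hpq
    rcases hp.eq_or_lt with rfl | hp'
    · have hq' : 0 < q := by linarith
      positivity
    · positivity
  have k := key (u - 0) ((33/50) - u) (by linarith) (by linarith) (by norm_num)
  have e : hh u = (8/510526328421483) *
      (2449035644531250000000 * ((33/50) - u)^10 + 11260681152343750000000 * (u - 0) * ((33/50) - u)^9 + 27594616699218750000000 * (u - 0)^2 * ((33/50) - u)^8 + 43900950000000000000000 * (u - 0)^3 * ((33/50) - u)^7
       + 47665398252392578125000 * (u - 0)^4 * ((33/50) - u)^6 + 35379314978267578125000 * (u - 0)^5 * ((33/50) - u)^5 + 17768074951456054687500 * (u - 0)^6 * ((33/50) - u)^4 + 5797293979386547500000 * (u - 0)^7 * ((33/50) - u)^3 + 1112274618504644163750 * (u - 0)^8 * ((33/50) - u)^2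
       + 98346980630701128750 * (u - 0)^9 * ((33/50) - u) + 1142775703067455429 * (u - 0)^10) := by
    unfold hh
    ring
  rw [e]
  nlinarith [k]

lemma hh_neg (u : ℝ) (h1 : (17/25) ≤ u) (h2 : u ≤ (2033/2000)) : hh u < 0 := by
  have key : ∀ p q : ℝ, 0 ≤ p → 0 ≤ q → 0 < p + q →
      0 < 39116943687802999139205120000000000 * q^10 + 1527267623745441154581135360000000000 * p * q^9 + 9918812151421270438220660736000000000 * p^2 * q^8 + 30179924697649206312321731788800000000 * p^3 * q^7
       + 53055184972640127216133798789120000000 * p^4 * q^6 + 57775573177334536645329780671283200000 * p^5 * q^5 + 39241743031330745903145895657420800000 * p^6 * q^4 + 15954638252311234369685358975969280000 * p^7 * q^3 + 3536678421645430380452045990482544000 * p^8 * q^2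
       + 359906226153671420408378249111919600 * p^9 * q + 26298465677478993731161809036213 * p^10 := by
    intro p q hp hq hpq
    rcases hp.eq_or_lt with rfl | hp'
    · have hq' : 0 < q := by linarith
      positivity
    · positivity
  have k := key (u - (17/25)) ((2033/2000) - u) (by linarith) (by linarith) (by norm_num)
  have e : hh u = (-8/19061217732399154541663235649) *
      (39116943687802999139205120000000000 * ((2033/2000) - u)^10 + 1527267623745441154581135360000000000 * (u - (17/25)) * ((2033/2000) - u)^9 + 9918812151421270438220660736000000000 * (u - (17/25))^2 * ((2033/2000) - u)^8 + 30179924697649206312321731788800000000 * (u - (17/25))^3 * ((2033/2000) - u)^7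
       + 53055184972640127216133798789120000000 * (u - (17/25))^4 * ((2033/2000) - u)^6 + 57775573177334536645329780671283200000 * (u - (17/25))^5 * ((2033/2000) - u)^5 + 39241743031330745903145895657420800000 * (u - (17/25))^6 * ((2033/2000) - u)^4 + 15954638252311234369685358975969280000 * (u - (17/25))^7 * ((2033/2000) - u)^3 + 3536678421645430380452045990482544000 * (u - (17/25))^8 * ((2033/2000) - u)^2
       + 359906226153671420408378249111919600 * (u - (17/25))^9 * ((2033/2000) - u) + 26298465677478993731161809036213 * (u - (17/25))^10) := by
    unfold hh
    ring
  rw [e]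
  nlinarith [k]

lemma hh_pos1 (u : ℝ) (h1 : (1017/1000) ≤ u) (h2 : u ≤ 2) : 0 < hh u := by
  have key : ∀ p q : ℝ, 0 ≤ p → 0 ≤ q → 0 < p + q →
      0 < 495539301862216220746348886787 * q^10 + 1028418320778004691189453847395000 * p * q^9 + 6767383892133565297859190186500000 * p^2 * q^8 + 32668934101325816212077332000000000 * p^3 * q^7
       + 386838584035344545940943250000000000 * p^4 * q^6 + 2858918743104274342879250000000000000 * p^5 * q^5 + 11354212483461682896875000000000000000 * p^6 * q^4 + 26323477384893369000000000000000000000 * p^7 * q^3 + 36216961869424500000000000000000000000 * p^8 * q^2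
       + 27692828700750000000000000000000000000 * p^9 * q + 9198187875000000000000000000000000000 * p^10 := by
    intro p q hp hq hpq
    rcases hp.eq_or_lt with rfl | hp'
    · have hq' : 0 < q := by linarith
      positivity
    · positivity
  have k := key (u - (1017/1000)) (2 - u) (by linarith) (by linarith) (by norm_num)
  have e : hh u = (8/842432626625997574462073930449) *
      (495539301862216220746348886787 * (2 - u)^10 + 1028418320778004691189453847395000 * (u - (1017/1000)) * (2 - u)^9 + 6767383892133565297859190186500000 * (u - (1017/1000))^2 * (2 - u)^8 + 32668934101325816212077332000000000 * (u - (1017/1000))^3 * (2 - u)^7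
       + 386838584035344545940943250000000000 * (u - (1017/1000))^4 * (2 - u)^6 + 2858918743104274342879250000000000000 * (u - (1017/1000))^5 * (2 - u)^5 + 11354212483461682896875000000000000000 * (u - (1017/1000))^6 * (2 - u)^4 + 26323477384893369000000000000000000000 * (u - (1017/1000))^7 * (2 - u)^3 + 36216961869424500000000000000000000000 * (u - (1017/1000))^8 * (2 - u)^2
       + 27692828700750000000000000000000000000 * (u - (1017/1000))^9 * (2 - u) + 9198187875000000000000000000000000000 * (u - (1017/1000))^10) := by
    unfold hh
    ring
  rw [e]
  nlinarith [k]

lemma hh_pos2 (u : ℝ) (h1 : 2 ≤ u) : 0 < hh u := by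
  obtain ⟨t, rfl⟩ : ∃ t, u = t + 2 := ⟨u - 2, by ring⟩
  have ht : 0 ≤ t := by linarith
  have e : hh (t + 2) = 73585503 + 523206918 * t + 1663270164 * t^2 + 3118372104 * t^3
       + 3826323175 * t^4 + 3218596762 * t^5 + 1885037834 * t^6 + 761509472 * t^7 + 203824212 * t^8
       + 32768280 * t^9 + 2412504 * t^10 := by
    unfold hh
    ring
  rw [e]
  positivity

lemma hd_1 (u : ℝ) (h1 : (33/50) ≤ u) (h2 : u ≤ (17/25)) : hd u < 0 := by
  have key : ∀ p q : ℝ, 0 ≤ p → 0 ≤ q → 0 < p + q →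
      0 < 790174760000241586 * q^9 + 6958087055172218627 * p * q^8 + 27225979718225714584 * p^2 * q^7 + 62129787105012188808 * p^3 * q^6
       + 91124016540686476976 * p^4 * q^5 + 89078492035696443748 * p^5 * q^4 + 58038449968235698736 * p^6 * q^3 + 24303184419243477312 * p^7 * q^2 + 5934892576999474944 * p^8 * q
       + 643962949022976768 * p^9 := by
    intro p q hp hq hpq
    rcases hp.eq_or_lt with rfl | hp'
    · have hq' : 0 < q := by linarith
      positivity
    · positivity
  have k := key (u - (33/50)) ((17/25) - u) (by linarith) (by linarith) (by norm_num)
  have e : hd u = -80 *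
      (790174760000241586 * ((17/25) - u)^9 + 6958087055172218627 * (u - (33/50)) * ((17/25) - u)^8 + 27225979718225714584 * (u - (33/50))^2 * ((17/25) - u)^7 + 62129787105012188808 * (u - (33/50))^3 * ((17/25) - u)^6
       + 91124016540686476976 * (u - (33/50))^4 * ((17/25) - u)^5 + 89078492035696443748 * (u - (33/50))^5 * ((17/25) - u)^4 + 58038449968235698736 * (u - (33/50))^6 * ((17/25) - u)^3 + 24303184419243477312 * (u - (33/50))^7 * ((17/25) - u)^2 + 5934892576999474944 * (u - (33/50))^8 * ((17/25) - u)
       + 643962949022976768 * (u - (33/50))^9) := by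
    unfold hd
    ring
  rw [e]
  nlinarith [k]

lemma NN_1 (u : ℝ) (h1 : (33/50) ≤ u) (h2 : u ≤ (17/25)) : 0 < NN u := by
  have key : ∀ p q : ℝ, 0 ≤ p → 0 ≤ q → 0 < p + q →
      0 < 130872775259 * q^5 + 651196663978 * p * q^4 + 1295905475716 * p^2 * q^3 + 1289265515762 * p^3 * q^2
       + 641237335344 * p^4 * q + 127553403600 * p^5 := by
    intro p q hp hq hpq
    rcases hp.eq_or_lt with rfl | hp'
    · have hq' : 0 < q := by linarith
      positivity
    · positivity
  have k := key (u - (33/50)) ((17/25) - u) (by linarith) (by linarith) (by norm_num)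
  have e : NN u = 200 *
      (130872775259 * ((17/25) - u)^5 + 651196663978 * (u - (33/50)) * ((17/25) - u)^4 + 1295905475716 * (u - (33/50))^2 * ((17/25) - u)^3 + 1289265515762 * (u - (33/50))^3 * ((17/25) - u)^2
       + 641237335344 * (u - (33/50))^4 * ((17/25) - u) + 127553403600 * (u - (33/50))^5) := by
    unfold NN
    ring
  rw [e]
  nlinarith [k]

lemma DD_1 (u : ℝ) (h1 : (33/50) ≤ u) (h2 : u ≤ (17/25)) : 0 < DD u := by
  have key : ∀ p q : ℝ, 0 ≤ p → 0 ≤ q → 0 < p + q →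
      0 < 111051738533 * q^4 + 447949568636 * p * q^3 + 676960677142 * p^2 * q^2 + 454297834744 * p^3 * q
       + 114234131328 * p^4 := by
    intro p q hp hq hpq
    rcases hp.eq_or_lt with rfl | hp'
    · have hq' : 0 < q := by linarith
      positivity
    · positivity
  have k := key (u - (33/50)) ((17/25) - u) (by linarith) (by linarith) (by norm_num)
  have e : DD u = 2 *
      (111051738533 * ((17/25) - u)^4 + 447949568636 * (u - (33/50)) * ((17/25) - u)^3 + 676960677142 * (u - (33/50))^2 * ((17/25) - u)^2 + 454297834744 * (u - (33/50))^3 * ((17/25) - u)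
       + 114234131328 * (u - (33/50))^4) := by
    unfold DD
    ring
  rw [e]
  nlinarith [k]

lemma s1_1 (u : ℝ) (h1 : (33/50) ≤ u) (h2 : u ≤ (17/25)) : s1 u < 0 := by
  have key : ∀ p q : ℝ, 0 ≤ p → 0 ≤ q → 0 < p + q →
      0 < 40094602774411266 * q^9 + 382390851006910887 * p * q^8 + 1621253233589252254 * p^2 * q^7 + 4009614761171484598 * p^3 * q^6
       + 6373344145892055856 * p^4 * q^5 + 6750922397219253988 * p^5 * q^4 + 4764621183978785416 * p^6 * q^3 + 2160328986604856872 * p^7 * q^2 + 570954595661693664 * p^8 * q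
       + 67010765893492608 * p^9 := by
    intro p q hp hq hpq
    rcases hp.eq_or_lt with rfl | hp'
    · have hq' : 0 < q := by linarith
      positivity
    · positivity
  have k := key (u - (33/50)) ((17/25) - u) (by linarith) (by linarith) (by norm_num)
  have e : s1 u = -64 *
      (40094602774411266 * ((17/25) - u)^9 + 382390851006910887 * (u - (33/50)) * ((17/25) - u)^8 + 1621253233589252254 * (u - (33/50))^2 * ((17/25) - u)^7 + 4009614761171484598 * (u - (33/50))^3 * ((17/25) - u)^6
       + 6373344145892055856 * (u - (33/50))^4 * ((17/25) - u)^5 + 6750922397219253988 * (u - (33/50))^5 * ((17/25) - u)^4 + 4764621183978785416 * (u - (33/50))^6 * ((17/25) - u)^3 + 2160328986604856872 * (u - (33/50))^7 * ((17/25) - u)^2 + 570954595661693664 * (u - (33/50))^8 * ((17/25) - u)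
       + 67010765893492608 * (u - (33/50))^9) := by
    unfold s1
    ring
  rw [e]
  nlinarith [k]

lemma A_1 (u : ℝ) (h1 : (33/50) ≤ u) (h2 : u ≤ (17/25)) : 0 < (-3 * DD u^2 - 6 * DD u^2 * u^2 + 5 * NN u * DD u + 10 * NN u * DD u * u
       - 3 * NN u^2) := by
  have key : ∀ p q : ℝ, 0 ≤ p → 0 ≤ q → 0 < p + q →
      0 < 78023505070331794046659487 * q^10 + 795666608933277585527192260 * p * q^9 + 3648032990911594401870430410 * p^2 * q^8 + 9903146515362424582017945480 * p^3 * q^7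
       + 17628158869706100056397419820 * p^4 * q^6 + 21500654509849449588970268832 * p^5 * q^5 + 18197764837464294144349506280 * p^6 * q^4 + 10554236556999263439444951680 * p^7 * q^3 + 4014375969630994826249994240 * p^8 * q^2
       + 904256177170342898642434560 * p^9 * q + 91604195531441814001010688 * p^10 := by
    intro p q hp hq hpq
    rcases hp.eq_or_lt with rfl | hp'
    · have hq' : 0 < q := by linarith
      positivity
    · positivity
  have k := key (u - (33/50)) ((17/25) - u) (by linarith) (by linarith) (by norm_num)
  have e : (-3 * DD u^2 - 6 * DD u^2 * u^2 + 5 * NN u * DD u + 10 * NN u * DD u * u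
       - 3 * NN u^2) = 8 *
      (78023505070331794046659487 * ((17/25) - u)^10 + 795666608933277585527192260 * (u - (33/50)) * ((17/25) - u)^9 + 3648032990911594401870430410 * (u - (33/50))^2 * ((17/25) - u)^8 + 9903146515362424582017945480 * (u - (33/50))^3 * ((17/25) - u)^7
       + 17628158869706100056397419820 * (u - (33/50))^4 * ((17/25) - u)^6 + 21500654509849449588970268832 * (u - (33/50))^5 * ((17/25) - u)^5 + 18197764837464294144349506280 * (u - (33/50))^6 * ((17/25) - u)^4 + 10554236556999263439444951680 * (u - (33/50))^7 * ((17/25) - u)^3 + 4014375969630994826249994240 * (u - (33/50))^8 * ((17/25) - u)^2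
       + 904256177170342898642434560 * (u - (33/50))^9 * ((17/25) - u) + 91604195531441814001010688 * (u - (33/50))^10) := by
    unfold NN DD
    ring
  rw [e]
  nlinarith [k]

lemma hd_2 (u : ℝ) (h1 : (2033/2000) ≤ u) (h2 : u ≤ (1017/1000)) : 0 < hd u := by
  have key : ∀ p q : ℝ, 0 ≤ p → 0 ≤ q → 0 < p + q →
      0 < 53438817458677062477127285441539 * q^9 + 480817457507085468684995108733998 * p * q^8 + 1922742836501416011690000532634416 * p^2 * q^7 + 4485171718938464191651084296196192 * p^3 * q^6
       + 6725917367721402013396582941381024 * p^4 * q^5 + 6724079306376956517837206994418752 * p^5 * q^4 + 4481495603381442375961719337707264 * p^6 * q^3 + 1920117049863362651555725613874688 * p^7 * q^2 + 479898437532677434854525869325056 * p^8 * q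
       + 53307529909746068650943953567232 * p^9 := by
    intro p q hp hq hpq
    rcases hp.eq_or_lt with rfl | hp'
    · have hq' : 0 < q := by linarith
      positivity
    · positivity
  have k := key (u - (2033/2000)) ((1017/1000) - u) (by linarith) (by linarith) (by norm_num)
  have e : hd u = 80 *
      (53438817458677062477127285441539 * ((1017/1000) - u)^9 + 480817457507085468684995108733998 * (u - (2033/2000)) * ((1017/1000) - u)^8 + 1922742836501416011690000532634416 * (u - (2033/2000))^2 * ((1017/1000) - u)^7 + 4485171718938464191651084296196192 * (u - (2033/2000))^3 * ((1017/1000) - u)^6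
       + 6725917367721402013396582941381024 * (u - (2033/2000))^4 * ((1017/1000) - u)^5 + 6724079306376956517837206994418752 * (u - (2033/2000))^5 * ((1017/1000) - u)^4 + 4481495603381442375961719337707264 * (u - (2033/2000))^6 * ((1017/1000) - u)^3 + 1920117049863362651555725613874688 * (u - (2033/2000))^7 * ((1017/1000) - u)^2 + 479898437532677434854525869325056 * (u - (2033/2000))^8 * ((1017/1000) - u)
       + 53307529909746068650943953567232 * (u - (2033/2000))^9) := by
    unfold hd
    ring
  rw [e]
  nlinarith [k]

lemma NN_2 (u : ℝ) (h1 : (2033/2000) ≤ u) (h2 : u ≤ (1017/1000)) : 0 < NN u := by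
  have key : ∀ p q : ℝ, 0 ≤ p → 0 ≤ q → 0 < p + q →
      0 < 2342085556734434493 * q^5 + 11684867230160668290 * p * q^4 + 23318591317640669960 * p^2 * q^3 + 23267426120719981840 * p^3 * q^2
       + 11608119425475888400 * p^4 * q + 2316502948970339744 * p^5 := by
    intro p q hp hq hpq
    rcases hp.eq_or_lt with rfl | hp'
    · have hq' : 0 < q := by linarith
      positivity
    · positivity
  have k := key (u - (2033/2000)) ((1017/1000) - u) (by linarith) (by linarith) (by norm_num)
  have e : NN u = 200 *
      (2342085556734434493 * ((1017/1000) - u)^5 + 11684867230160668290 * (u - (2033/2000)) * ((1017/1000) - u)^4 + 23318591317640669960 * (u - (2033/2000))^2 * ((1017/1000) - u)^3 + 23267426120719981840 * (u - (2033/2000))^3 * ((1017/1000) - u)^2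
       + 11608119425475888400 * (u - (2033/2000))^4 * ((1017/1000) - u) + 2316502948970339744 * (u - (2033/2000))^5) := by
    unfold NN
    ring
  rw [e]
  nlinarith [k]

lemma DD_2 (u : ℝ) (h1 : (2033/2000) ≤ u) (h2 : u ≤ (1017/1000)) : 0 < DD u := by
  have key : ∀ p q : ℝ, 0 ≤ p → 0 ≤ q → 0 < p + q →
      0 < 28285295110059783 * q^4 + 111933471646806136 * p * q^3 + 166086667940948392 * p^2 * q^2 + 109514099668619744 * p^3 * q
       + 27075608263561328 * p^4 := by
    intro p q hp hq hpq
    rcases hp.eq_or_lt with rfl | hp'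
    · have hq' : 0 < q := by linarith
      positivity
    · positivity
  have k := key (u - (2033/2000)) ((1017/1000) - u) (by linarith) (by linarith) (by norm_num)
  have e : DD u = 2 *
      (28285295110059783 * ((1017/1000) - u)^4 + 111933471646806136 * (u - (2033/2000)) * ((1017/1000) - u)^3 + 166086667940948392 * (u - (2033/2000))^2 * ((1017/1000) - u)^2 + 109514099668619744 * (u - (2033/2000))^3 * ((1017/1000) - u)
       + 27075608263561328 * (u - (2033/2000))^4) := by
    unfold DD
    ring
  rw [e]
  nlinarith [k]

lemma s1_2 (u : ℝ) (h1 : (2033/2000) ≤ u) (h2 : u ≤ (1017/1000)) : 0 < s1 u := by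
  have key : ∀ p q : ℝ, 0 ≤ p → 0 ≤ q → 0 < p + q →
      0 < 558034663361770611480057868359 * q^9 + 7785789382620201641591354687238 * p * q^8 + 42210331606934907588125558320496 * p^2 * q^7 + 124345159098707447343985399005152 * p^3 * q^6
       + 225345828728160742604036150522144 * p^4 * q^5 + 264220474203117094705827649800512 * p^5 * q^4 + 202094478966630715519457580579584 * p^6 * q^3 + 97745601395476449611813670000128 * p^7 * q^2 + 27223155497131427044830252654336 * p^8 * q
       + 3334805382298370064711526651392 * p^9 := by
    intro p q hp hq hpq
    rcases hp.eq_or_lt with rfl | hp'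
    · have hq' : 0 < q := by linarith
      positivity
    · positivity
  have k := key (u - (2033/2000)) ((1017/1000) - u) (by linarith) (by linarith) (by norm_num)
  have e : s1 u = 64 *
      (558034663361770611480057868359 * ((1017/1000) - u)^9 + 7785789382620201641591354687238 * (u - (2033/2000)) * ((1017/1000) - u)^8 + 42210331606934907588125558320496 * (u - (2033/2000))^2 * ((1017/1000) - u)^7 + 124345159098707447343985399005152 * (u - (2033/2000))^3 * ((1017/1000) - u)^6
       + 225345828728160742604036150522144 * (u - (2033/2000))^4 * ((1017/1000) - u)^5 + 264220474203117094705827649800512 * (u - (2033/2000))^5 * ((1017/1000) - u)^4 + 202094478966630715519457580579584 * (u - (2033/2000))^6 * ((1017/1000) - u)^3 + 97745601395476449611813670000128 * (u - (2033/2000))^7 * ((1017/1000) - u)^2 + 27223155497131427044830252654336 * (u - (2033/2000))^8 * ((1017/1000) - u)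
       + 3334805382298370064711526651392 * (u - (2033/2000))^9) := by
    unfold s1
    ring
  rw [e]
  nlinarith [k]

lemma A_2 (u : ℝ) (h1 : (2033/2000) ≤ u) (h2 : u ≤ (1017/1000)) : 0 < (-3 * DD u^2 - 6 * DD u^2 * u^2 + 5 * NN u * DD u + 10 * NN u * DD u * u
       - 3 * NN u^2) := by
  have key : ∀ p q : ℝ, 0 ≤ p → 0 ≤ q → 0 < p + q →
      0 < 3461989705131626515822016449626280174737 * q^10 + 32310345782508446871654963312330631954260 * p * q^9 + 135008448500791366871933594188618274220660 * p^2 * q^8 + 332333909481479202265254435243838963308480 * p^3 * q^7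
       + 533152015971614574109556129317038740588320 * p^4 * q^6 + 581690949859973135462940236797877995304832 * p^5 * q^5 + 436355677040446113301907009707205170097280 * p^6 * q^4 + 221709532071974690932057495798132606663680 * p^7 * q^3 + 72782245527046005294554749540712507178240 * p^8 * q^2
       + 13872956174490920775213836846016549442560 * p^9 * q + 1157316625396710213347468793938086642688 * p^10 := by
    intro p q hp hq hpq
    rcases hp.eq_or_lt with rfl | hp'
    · have hq' : 0 < q := by linarith
      positivity
    · positivity
  have k := key (u - (2033/2000)) ((1017/1000) - u) (by linarith) (by linarith) (by norm_num)
  have e : (-3 * DD u^2 - 6 * DD u^2 * u^2 + 5 * NN u * DD u + 10 * NN u * DD u * u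
       - 3 * NN u^2) = 8 *
      (3461989705131626515822016449626280174737 * ((1017/1000) - u)^10 + 32310345782508446871654963312330631954260 * (u - (2033/2000)) * ((1017/1000) - u)^9 + 135008448500791366871933594188618274220660 * (u - (2033/2000))^2 * ((1017/1000) - u)^8 + 332333909481479202265254435243838963308480 * (u - (2033/2000))^3 * ((1017/1000) - u)^7
       + 533152015971614574109556129317038740588320 * (u - (2033/2000))^4 * ((1017/1000) - u)^6 + 581690949859973135462940236797877995304832 * (u - (2033/2000))^5 * ((1017/1000) - u)^5 + 436355677040446113301907009707205170097280 * (u - (2033/2000))^6 * ((1017/1000) - u)^4 + 221709532071974690932057495798132606663680 * (u - (2033/2000))^7 * ((1017/1000) - u)^3 + 72782245527046005294554749540712507178240 * (u - (2033/2000))^8 * ((1017/1000) - u)^2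
       + 13872956174490920775213836846016549442560 * (u - (2033/2000))^9 * ((1017/1000) - u) + 1157316625396710213347468793938086642688 * (u - (2033/2000))^10) := by
    unfold NN DD
    ring
  rw [e]
  nlinarith [k]

lemma q_case (x u : ℝ) (hq : 6 * u^2 - 10 * u + 3 = 0) (hL : s1 u * x + s0 u = 0) : x = 1 := by
  have e1 : s1 u = (6 * u^2 - 10 * u + 3) * ((7667300/81) + (423400/27) * u + (17877500/9) * u^2 - (7930760/3) * u^3
       - 194800 * u^4 + 4985216 * u^5 - 5226480 * u^6 + 2128032 * u^7) + (-(21882800/27) + (157620800/81) * u) := by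
    unfold s1
    ring
  have e2 : s1 u + s0 u = (6 * u^2 - 10 * u + 3) * (-7200 - 484600 * u + 1851000 * u^2 - 1531960 * u^3
       - 3772056 * u^4 + 10802432 * u^5 - 11886816 * u^6 + 6610464 * u^7 - 1578528 * u^8) := by
    unfold s1 s0
    ring
  rw [hq, zero_mul] at e1 e2
  have h1 : s1 u ≠ 0 := by
    intro h0
    have hu : u = (164121/394052) := by linarith
    rw [hu] at hq
    norm_num at hq
  have : s1 u * (x - 1) = 0 := by linarith
  have := (mul_eq_zero.mp this).resolve_left h1
  linarith

lemma hh_deriv (u : ℝ) : HasDerivAt hh (hd u) u := by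
  have e : hh = fun u => ∑ i ∈ Finset.range 11, (![601875, -4926250, 20567500, -55868000, 105439675,
      -141888350, 137946250, -97049440, 48245892, -15481800, 2412504] :
      Fin 11 → ℝ) (Fin.ofNat 11 i) * u ^ i := by
    funext v
    simp [Finset.sum_range_succ, Fin.ofNat, hh]
    ring
  rw [e]
  have := HasDerivAt.fun_sum (u := Finset.range 11) (x := u)
    (A := fun i v => (![601875, -4926250, 20567500, -55868000, 105439675,
      -141888350, 137946250, -97049440, 48245892, -15481800, 2412504] :
      Fin 11 → ℝ) (Fin.ofNat 11 i) * v ^ i)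
    (fun i _ => (hasDerivAt_pow i u).const_mul _)
  refine this.congr_deriv ?_
  simp [Finset.sum_range_succ, Fin.ofNat, hd]
  ring

lemma hh_cont : Continuous hh :=
  continuous_iff_continuousAt.mpr fun u => (hh_deriv u).continuousAt

lemma hh_anti : StrictAntiOn hh (Set.Icc (33/50) (17/25)) := by
  apply strictAntiOn_of_deriv_neg (convex_Icc _ _) hh_cont.continuousOn
  intro u hu
  rw [interior_Icc] at hu
  rw [(hh_deriv u).deriv]
  exact hd_1 u hu.1.le hu.2.le

lemma hh_mono : StrictMonoOn hh (Set.Icc (2033/2000) (1017/1000)) := by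
  apply strictMonoOn_of_deriv_pos (convex_Icc _ _) hh_cont.continuousOn
  intro u hu
  rw [interior_Icc] at hu
  rw [(hh_deriv u).deriv]
  exact hd_2 u hu.1.le hu.2.le

lemma exists_r1 : ∃ r ∈ Set.Icc (33/50 : ℝ) (17/25), hh r = 0 := by
  have h := intermediate_value_Icc' (show (33/50 : ℝ) ≤ 17/25 by norm_num) hh_cont.continuousOn
  have h0 : (0 : ℝ) ∈ Set.Icc (hh (17/25)) (hh (33/50)) :=
    ⟨(hh_neg _ le_rfl (by norm_num)).le, (hh_pos0 _ (by norm_num) le_rfl).le⟩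
  obtain ⟨r, hr, h1⟩ := h h0
  exact ⟨r, hr, h1⟩

lemma exists_r2 : ∃ r ∈ Set.Icc (2033/2000 : ℝ) (1017/1000), hh r = 0 := by
  have h := intermediate_value_Icc (show (2033/2000 : ℝ) ≤ 1017/1000 by norm_num)
    hh_cont.continuousOn
  have h0 : (0 : ℝ) ∈ Set.Icc (hh (2033/2000)) (hh (1017/1000)) :=
    ⟨(hh_neg _ (by norm_num) le_rfl).le, (hh_pos1 _ le_rfl (by norm_num)).le⟩
  obtain ⟨r, hr, h1⟩ := h h0
  exact ⟨r, hr, h1⟩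

lemma root_loc (u : ℝ) (hu : 0 < u) (h : hh u = 0) :
    u ∈ Set.Icc (33/50 : ℝ) (17/25) ∨ u ∈ Set.Icc (2033/2000 : ℝ) (1017/1000) := by
  have n0 : ¬ u ≤ 33/50 := fun k => (hh_pos0 u hu.le k).ne' h
  have n1 : ¬ (17/25 ≤ u ∧ u ≤ 2033/2000) := fun k => (hh_neg u k.1 k.2).ne h
  have n2 : ¬ (1017/1000 ≤ u ∧ u ≤ 2) := fun k => (hh_pos1 u k.1 k.2).ne' h
  have n3 : ¬ (2 ≤ u) := fun k => (hh_pos2 u k).ne' h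
  push Not at n0 n1 n2 n3
  rcases le_or_gt u (17/25) with k | k
  · exact Or.inl ⟨n0.le, k⟩
  · refine Or.inr ⟨(n1 k.le).le, ?_⟩
    by_contra k2
    push Not at k2
    linarith [n2 k2.le]

/-- The reduced solution set. -/
def SS : Set (ℝ × ℝ) :=
  {w | 0 < w.1 ∧ 0 < w.2 ∧ 0 < aa w.1 w.2 ∧ PP w.1 w.2 = 0 ∧ QQ w.1 w.2 = 0}

lemma aa_pos_of (u : ℝ) (hD : 0 < DD u)
    (h : 0 < DD u ^ 2 * aa (NN u / DD u) u) : 0 < aa (NN u / DD u) u := by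
  have : 0 < DD u ^ 2 := by positivity
  exact (mul_pos_iff_of_pos_left this).mp h

lemma aa_exp (u N d : ℝ) (hd : d ≠ 0) : d ^ 2 * aa (N / d) u =
    -3 * d ^ 2 - 6 * d ^ 2 * u ^ 2 + 5 * N * d + 10 * N * d * u - 3 * N ^ 2 := by
  unfold aa
  field_simp

lemma mem1 (u : ℝ) (hu : u ∈ Set.Icc (33/50 : ℝ) (17/25)) (h : hh u = 0) :
    (NN u / DD u, u) ∈ SS := by
  have hD := DD_1 u hu.1 hu.2
  have hN := NN_1 u hu.1 hu.2
  refine ⟨div_pos hN hD, ?_, ?_, van_PP u h hD.ne', van_QQ u h hD.ne'⟩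
  · have := hu.1
    change 0 < u
    linarith
  · apply aa_pos_of u hD
    rw [aa_exp _ _ _ hD.ne']
    linarith [A_1 u hu.1 hu.2]

lemma mem2 (u : ℝ) (hu : u ∈ Set.Icc (2033/2000 : ℝ) (1017/1000)) (h : hh u = 0) :
    (NN u / DD u, u) ∈ SS := by
  have hD := DD_2 u hu.1 hu.2
  have hN := NN_2 u hu.1 hu.2
  refine ⟨div_pos hN hD, ?_, ?_, van_PP u h hD.ne', van_QQ u h hD.ne'⟩
  · have := hu.1
    change 0 < u
    linarith
  · apply aa_pos_of u hD
    rw [aa_exp _ _ _ hD.ne']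
    linarith [A_2 u hu.1 hu.2]

lemma memq (u : ℝ) (hu : 0 < u) (h : 6 * u^2 - 10 * u + 3 = 0) : (1, u) ∈ SS := by
  have ha : aa 1 u = 2 := by
    unfold aa
    linarith
  refine ⟨one_pos, hu, ?_, ?_, ?_⟩
  · change 0 < aa 1 u
    rw [ha]
    norm_num
  · change PP 1 u = 0
    unfold PP
    rw [ha]
    ring
  · change QQ 1 u = 0
    unfold QQ
    rw [ha]
    linarith

lemma x_eq (x u : ℝ) (h : hh u = 0) (hD : DD u ≠ 0) (hs : s1 u ≠ 0)
    (hL : s1 u * x + s0 u = 0) : x = NN u / DD u := by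
  have k := rel_ND u h
  rw [eq_div_iff hD]
  apply mul_left_cancel₀ hs
  linear_combination DD u * hL - k

lemma SS_card : SS.ncard = 4 := by
  obtain ⟨r1, hr1, h1⟩ := exists_r1
  obtain ⟨r2, hr2, h2⟩ := exists_r2
  have h7 : Real.sqrt 7 ^ 2 = 7 := Real.sq_sqrt (by norm_num)
  have h7a : 2.64 < Real.sqrt 7 := Real.lt_sqrt_of_sq_lt (by norm_num)
  have h7b : Real.sqrt 7 < 2.65 := (Real.sqrt_lt' (by norm_num)).mpr (by norm_num)
  set s := Real.sqrt 7
  have e : SS = {(1, (5 - s) / 6), (1, (5 + s) / 6), (NN r1 / DD r1, r1), (NN r2 / DD r2, r2)} := by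
    ext ⟨x, u⟩
    constructor
    · rintro ⟨hx, hu, ha, hP, hQ⟩
      change 0 < u at hu
      have hL := elim_L x u hP hQ
      rcases mul_eq_zero.mp (elim_R x u hP hQ) with hq | hh0
      · have hx1 := q_case x u hq hL
        have : (u - (5 - s) / 6) * (u - (5 + s) / 6) = 0 := by nlinarith
        rcases mul_eq_zero.mp this with k | k
        · left
          rw [hx1, sub_eq_zero.mp k]
        · right; left
          rw [hx1, sub_eq_zero.mp k]
      · rcases root_loc u hu hh0 with k | k
        · have : u = r1 := hh_anti.injOn k hr1 (hh0.trans h1.symm)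
          right; right; left
          rw [x_eq x u hh0 (DD_1 u k.1 k.2).ne' (s1_1 u k.1 k.2).ne hL, this]
        · have : u = r2 := hh_mono.injOn k hr2 (hh0.trans h2.symm)
          right; right; right
          rw [x_eq x u hh0 (DD_2 u k.1 k.2).ne' (s1_2 u k.1 k.2).ne' hL, this]
          rfl
    · rintro (k | k | k | k)
      · rw [k]
        exact memq _ (by linarith) (by nlinarith)
      · rw [k]
        exact memq _ (by linarith) (by nlinarith)
      · rw [k]
        exact mem1 _ hr1 h1
      · rw [Set.mem_singleton_iff.mp k]
        exact mem2 _ hr2 h2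
  obtain ⟨ha, hb⟩ := hr1
  obtain ⟨hc, hd'⟩ := hr2
  have d12 : (5 - s) / 6 ≠ (5 + s) / 6 := by
    intro h
    linarith
  have d13 : (5 - s) / 6 ≠ r1 := by
    intro h
    linarith
  have d14 : (5 - s) / 6 ≠ r2 := by
    intro h
    linarith
  have d23 : (5 + s) / 6 ≠ r1 := by
    intro h
    linarith
  have d24 : (5 + s) / 6 ≠ r2 := by
    intro h
    linarith
  have d34 : r1 ≠ r2 := by
    intro h
    linarith
  rw [e, Set.ncard_insert_of_notMem, Set.ncard_insert_of_notMem, Set.ncard_pair]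
  · intro h
    exact d34 (Prod.mk.inj h).2
  · rintro (h | h)
    · exact d23 (Prod.mk.inj h).2
    · exact d24 (Prod.mk.inj h).2
  · rintro (h | h | h)
    · exact d12 (Prod.mk.inj h).2
    · exact d13 (Prod.mk.inj h).2
    · exact d14 (Prod.mk.inj h).2

lemma T_iff (x y z : ℝ) (hx : 0 < x) (hy : 0 < y) (hz : 0 < z) :
    (T₁ 4 2 x y z = 0 ∧ T₂ 4 2 x y z = 0 ∧ T₃ 4 2 x y z = 0) ↔
      (2 * (x / y) * z = aa x (x / y) ∧ PP x (x / y) = 0 ∧ QQ x (x / y) = 0) := by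
  obtain ⟨u, rfl⟩ : ∃ u, x = u * y := ⟨x / y, by field_simp⟩
  have hu : 0 < u := pos_of_mul_pos_left hx hy.le
  have hd : u * y / y = u := by field_simp
  rw [hd]
  have e12 : y * T₁ 4 2 (u * y) y z + 2 * (u * y) * T₂ 4 2 (u * y) y z =
      2 * u * y^4 * z * (aa (u * y) u - 2 * u * z) := by
    unfold T₁ T₂ aa
    ring
  have e2 : 2 * T₂ 4 2 (u * y) y z * (2 * u) = - y^3 * (PP (u * y) u) + y^3 *
      (aa (u * y) u - 2 * u * z) *
        (-2 * (u * y)^2 - 2 * u^2 + 10 * (u * y) - 4 - aa (u * y) u + 2 * u * z) := by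
    unfold T₂ PP aa
    ring
  have e3 : T₃ 4 2 (u * y) y z * u = - z * y^2 * (QQ (u * y) u + (2 * u * z - aa (u * y) u) *
      ((u * y)^2 + u^2 + 1/2 - aa (u * y) u - 2 * u * z)) := by
    unfold T₃ QQ aa
    ring
  constructor
  · rintro ⟨h1, h2, h3⟩
    rw [h1, h2] at e12
    have hz : 2 * u * z = aa (u * y) u := by
      have : 2 * u * y^4 * z ≠ 0 := by positivity
      have := (mul_eq_zero.mp (e12.symm.trans (by ring))).resolve_left this
      linarith
    rw [h2, hz] at e2
    rw [h3, hz] at e3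
    refine ⟨hz, ?_, ?_⟩
    · have : y^3 ≠ 0 := by positivity
      apply mul_left_cancel₀ this
      linarith
    · have : z * y^2 ≠ 0 := by positivity
      apply mul_left_cancel₀ this
      linarith
  · rintro ⟨hz, hP, hQ⟩
    rw [hz, hP] at e2
    rw [hz, hQ] at e3
    have h2 : T₂ 4 2 (u * y) y z = 0 := by
      apply mul_left_cancel₀ hu.ne'
      linarith
    have h3 : T₃ 4 2 (u * y) y z = 0 := by
      apply mul_left_cancel₀ hu.ne'
      linarith
    rw [hz, h2] at e12
    refine ⟨?_, h2, h3⟩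
    apply mul_left_cancel₀ hy.ne'
    linarith

theorem stiefel_V5R7_exactly_four_singularities :
    {p : ℝ × ℝ × ℝ | 0 < p.1 ∧ 0 < p.2.1 ∧ 0 < p.2.2 ∧
      T₁ 4 2 p.1 p.2.1 p.2.2 = 0 ∧ T₂ 4 2 p.1 p.2.1 p.2.2 = 0 ∧
      T₃ 4 2 p.1 p.2.1 p.2.2 = 0}.ncard = 4 := by
  have e : {p : ℝ × ℝ × ℝ | 0 < p.1 ∧ 0 < p.2.1 ∧ 0 < p.2.2 ∧
      T₁ 4 2 p.1 p.2.1 p.2.2 = 0 ∧ T₂ 4 2 p.1 p.2.1 p.2.2 = 0 ∧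
      T₃ 4 2 p.1 p.2.1 p.2.2 = 0} =
      (fun w : ℝ × ℝ => (w.1, w.1 / w.2, aa w.1 w.2 / (2 * w.2))) '' SS := by
    ext ⟨x, y, z⟩
    constructor
    · rintro ⟨hx, hy, hz, h⟩
      change 0 < x at hx
      change 0 < y at hy
      change 0 < z at hz
      obtain ⟨ha, hP, hQ⟩ := (T_iff x y z hx hy hz).mp h
      have hu : 0 < x / y := by positivity
      refine ⟨(x, x / y), ⟨hx, hu, ?_, hP, hQ⟩, ?_⟩
      · change 0 < aa x (x / y)
        rw [← ha]
        positivity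
      · change (x, x / (x / y), aa x (x / y) / (2 * (x / y))) = (x, y, z)
        rw [← ha]
        have k1 : x / (x / y) = y := by field_simp
        have k2 : 2 * (x / y) * z / (2 * (x / y)) = z := by field_simp
        rw [k1, k2]
    · rintro ⟨⟨x', u⟩, ⟨hx, hu, ha, hP, hQ⟩, heq⟩
      change 0 < x' at hx
      change 0 < u at hu
      change 0 < aa x' u at ha
      obtain ⟨rfl, rfl, rfl⟩ : x' = x ∧ x' / u = y ∧ aa x' u / (2 * u) = z := by
        simpa using heq
      have hxu : x' / (x' / u) = u := by field_simp
      have hy : 0 < x' / u := by positivity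
      have hz : 0 < aa x' u / (2 * u) := by positivity
      refine ⟨hx, hy, hz, (T_iff _ _ _ hx hy hz).mpr ?_⟩
      rw [hxu]
      exact ⟨by field_simp, hP, hQ⟩
  rw [e, Set.ncard_image_of_injOn, SS_card]
  rintro ⟨x, u⟩ ⟨hx, hu, -⟩ ⟨x', u'⟩ ⟨hx', hu', -⟩ h
  simp only [Prod.mk.injEq] at h hx hu hx' hu' ⊢
  obtain ⟨rfl, h, -⟩ := h
  refine ⟨rfl, ?_⟩
  rw [div_eq_div_iff hu.ne' hu'.ne'] at h
  exact (mul_left_cancel₀ hx.ne' h).symm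
end
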